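/- arXiv:2509.05711 — 2 statements merged into one kernel-verified Lean document; each statement's English description precedes it below -/
import Mathlib

section
/- Every star-shaped Kakeya set E ⊂ ℝ² satisfies ℒ₂*(E) ≥ π/108. -/
open MeasureTheory Metric Set

/-- The unit vector in direction `α`. -/
noncomputable def dirVec (α : ℝ) : EuclideanSpace ℝ (Fin 2) :=
  (WithLp.equiv 2 (Fin 2 → ℝ)).symm ![Real.cos α, Real.sin α]

namespace StarKakeya

instance factPi : Fact (0 < Real.pi) := ⟨Real.pi_pos⟩

/-- The direction of a complex number modulo `π`. -/
noncomputable def dirMod (z : ℂ) : AddCircle Real.pi := ((Complex.arg z : ℝ) : AddCircle Real.pi)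

lemma measurable_dirMod : Measurable dirMod :=
  AddCircle.measurable_mk'.comp Complex.measurable_arg

lemma dirMod_eq (r θ : ℝ) (hr : r ≠ 0) :
    dirMod ((r : ℂ) * ((Real.cos θ : ℂ) + (Real.sin θ : ℂ) * Complex.I)) = (θ : AddCircle Real.pi) := by
  set x : ℂ := (r : ℂ) * ((Real.cos θ : ℂ) + (Real.sin θ : ℂ) * Complex.I) with hx
  have hre : ‖x‖ * Real.cos x.arg = r * Real.cos θ := by
    rw [Complex.norm_mul_cos_arg]
    simp [hx, -Complex.ofReal_cos, -Complex.ofReal_sin]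
  have him : ‖x‖ * Real.sin x.arg = r * Real.sin θ := by
    rw [Complex.norm_mul_sin_arg]
    simp [hx, -Complex.ofReal_cos, -Complex.ofReal_sin]
  have hs : ‖x‖ * Real.sin (x.arg - θ) = 0 := by
    rw [Real.sin_sub]
    linear_combination Real.cos θ * him - Real.sin θ * hre
  have hn : ‖x‖ ≠ 0 := by
    intro h0
    rw [h0] at hre him
    have h1 : Real.cos θ = 0 := by
      have := hre.symm
      simpa [hr] using this
    have h2 : Real.sin θ = 0 := by
      have := him.symm
      simpa [hr] using this
    have := Real.sin_sq_add_cos_sq θ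
    rw [h1, h2] at this
    norm_num at this
  have hs' : Real.sin (x.arg - θ) = 0 := by
    rcases mul_eq_zero.1 hs with h | h
    · exact absurd h hn
    · exact h
  obtain ⟨n, hn⟩ := Real.sin_eq_zero_iff.1 hs'
  unfold dirMod
  rw [← sub_eq_zero, ← AddCircle.coe_sub, AddCircle.coe_eq_zero_iff]
  exact ⟨n, by rw [← hn]; simp⟩

lemma trig_ineq (t : ℝ) (h0 : 0 ≤ t) (h1 : t ≤ Real.pi / 2) :
    t ≤ Real.sin t * (2 - Real.cos t) := by
  have hd : ∀ x : ℝ, HasDerivAt (fun x => Real.sin x * (2 - Real.cos x) - x)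
      (Real.cos x * (2 - Real.cos x) + Real.sin x * (Real.sin x) - 1) x := by
    intro x
    have h := ((Real.hasDerivAt_sin x).mul ((Real.hasDerivAt_cos x).const_sub 2)).sub
      (hasDerivAt_id x)
    exact h.congr_deriv (by ring)
  have hm : MonotoneOn (fun x => Real.sin x * (2 - Real.cos x) - x) (Icc 0 (Real.pi / 2)) := by
    apply monotoneOn_of_deriv_nonneg (convex_Icc _ _)
    · exact fun x _ => (hd x).continuousAt.continuousWithinAt
    · exact fun x _ => (hd x).differentiableAt.differentiableWithinAt
    · intro x hx
      rw [interior_Icc] at hx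
      rw [(hd x).deriv]
      have hc : 0 ≤ Real.cos x := Real.cos_nonneg_of_mem_Icc ⟨by linarith [hx.1, Real.pi_pos], hx.2.le⟩
      have hc1 := Real.cos_le_one x
      nlinarith [Real.sin_sq_add_cos_sq x]
  have := hm ⟨le_rfl, by positivity⟩ ⟨h0, h1⟩ h0
  simp at this
  linarith

/-- The triangle with apex `0` and opposite side `[d + a i, d + b i]`. -/
def tri (d a b : ℝ) : Set ℂ :=
  {w | w.re ∈ Ioc 0 d ∧ w.im ∈ Ioo (a / d * w.re) (b / d * w.re)}

lemma tri_eq (d a b : ℝ) : tri d a b = Complex.measurableEquivRealProd ⁻¹'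
    (regionBetween (fun y => a / d * y) (fun y => b / d * y) (Ioc 0 d)) := by
  ext w
  simp [tri, regionBetween]

lemma measurableSet_tri (d a b : ℝ) : MeasurableSet (tri d a b) := by
  rw [tri_eq]
  apply Complex.measurableEquivRealProd.measurable
  exact measurableSet_regionBetween (by fun_prop) (by fun_prop) measurableSet_Ioc

lemma volume_tri (d a b : ℝ) (hd : 0 < d) (hab : a ≤ b) :
    volume (tri d a b) = ENNReal.ofReal (d * (b - a) / 2) := by
  rw [tri_eq, Complex.volume_preserving_equiv_real_prod.measure_preimage_equiv]
  rw [Measure.volume_eq_prod, volume_regionBetween_eq_integral]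
  · congr 1
    rw [← intervalIntegral.integral_of_le hd.le]
    have : ((fun y => b / d * y) - fun y => a / d * y) = fun y : ℝ => ((b - a) / d) * y := by
      ext y
      simp only [Pi.sub_apply]
      ring
    rw [this, intervalIntegral.integral_const_mul, integral_id]
    field_simp
    ring
  · exact (Continuous.integrableOn_Ioc (by fun_prop))
  · exact (Continuous.integrableOn_Ioc (by fun_prop))
  · exact measurableSet_Ioc
  · intro x hx
    have : 0 < x := hx.1
    gcongr

/-- Coordinates adapted to the direction `α`. -/
noncomputable def coord (ε α σ : ℝ) (w : ℂ) : ℂ :=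
  (ε : ℂ) * ((Real.cos α : ℂ) + (Real.sin α : ℂ) * Complex.I) *
    ((w.im : ℂ) + (σ * w.re : ℝ) * Complex.I)

lemma mp_coord (ε α σ : ℝ) (hε : ε = 1 ∨ ε = -1) (hσ : σ = 1 ∨ σ = -1) :
    MeasurePreserving (coord ε α σ) volume volume := by
  have hnorm : ‖(ε : ℂ) * ((Real.cos α : ℂ) + (Real.sin α : ℂ) * Complex.I) *
      (σ * Complex.I)‖ = 1 := by
    have h1 : ‖(Real.cos α : ℂ) + (Real.sin α : ℂ) * Complex.I‖ = 1 := by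
      have := Complex.norm_exp_ofReal_mul_I α
      rw [Complex.exp_mul_I] at this
      rwa [← Complex.ofReal_cos, ← Complex.ofReal_sin] at this
    rw [norm_mul, norm_mul, h1]
    rcases hε with h | h <;> rcases hσ with h' | h' <;> simp [h, h']
  set c : Circle := ⟨_, mem_sphere_zero_iff_norm.2 hnorm⟩ with hc
  have hrot : ∀ x : ℂ, rotation c x = (ε : ℂ) * ((Real.cos α : ℂ) + (Real.sin α : ℂ) * Complex.I) *
      (σ * Complex.I) * x := fun x => rotation_apply c x
  rcases hσ with h' | h'
  · have := (Complex.conjLIE.trans (rotation c)).measurePreserving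
    refine (?_ : coord ε α σ = _) ▸ this
    funext w
    simp only [coord, LinearIsometryEquiv.trans_apply, hrot, h']
    rw [Complex.conjLIE_apply]
    have hw : (starRingEnd ℂ) w = (w.re : ℂ) - w.im * Complex.I := by
      apply Complex.ext <;> simp
    rw [hw]
    push_cast
    linear_combination ((ε : ℂ) * (Complex.cos α + Complex.sin α * Complex.I) * w.im) * Complex.I_sq
  · have := (rotation c).measurePreserving
    refine (?_ : coord ε α σ = _) ▸ this
    funext w
    simp only [coord, hrot, h']
    conv_rhs => rw [← Complex.re_add_im w]
    push_cast
    linear_combination ((ε : ℂ) * (Complex.cos α + Complex.sin α * Complex.I) * w.im) * Complex.I_sq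

lemma dirMod_coord (ε α σ : ℝ) (hε : ε = 1 ∨ ε = -1) (hσ : σ = 1 ∨ σ = -1) (r s : ℝ) (hr : 0 < r)
    (w : ℂ) (h1 : w.im = r * Real.cos s) (h2 : w.re = r * Real.sin s) :
    dirMod (coord ε α σ w) = ((α + σ * s : ℝ) : AddCircle Real.pi) := by
  rw [← dirMod_eq (ε * r) (α + σ * s)]
  · congr 1
    rw [coord, h1, h2, Real.cos_add, Real.sin_add]
    rcases hσ with h | h
    · simp only [h, one_mul]
      push_cast
      linear_combination ((ε : ℂ) * r * Complex.sin α * Complex.sin s) * Complex.I_sq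
    · simp only [h, neg_mul, one_mul, Real.cos_neg, Real.sin_neg]
      push_cast
      linear_combination (-(ε : ℂ) * r * Complex.sin α * Complex.sin s) * Complex.I_sq
  · rcases hε with h | h <;> rw [h] <;> simp [ne_of_gt hr]

/-- If the cone over the segment lies in `U` then so does the image of the triangle. -/
lemma coord_tri_mem (U : Set ℂ) (ε α σ d a b : ℝ) (hd : 0 < d)
    (hU : ∀ l ∈ Icc (0 : ℝ) 1, ∀ z ∈ Icc a b, coord ε α σ ((l : ℂ) * (d + z * Complex.I)) ∈ U)
    (w : ℂ) (hw : w ∈ tri d a b) : coord ε α σ w ∈ U := by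
  obtain ⟨⟨h0, h1⟩, h2, h3⟩ := hw
  have hwre := h0.ne'
  have : w = ((w.re / d : ℝ) : ℂ) * ((d : ℂ) + ((w.im * d / w.re : ℝ) : ℂ) * Complex.I) := by
    apply Complex.ext
    · simp
      field_simp
    · simp
      field_simp
  rw [this]
  apply hU
  · exact ⟨by positivity, (div_le_one hd).2 h1⟩
  · constructor
    · rw [le_div_iff₀ h0]
      rw [div_mul_eq_mul_div, div_lt_iff₀ hd] at h2
      exact h2.le
    · rw [div_le_iff₀ h0]
      rw [div_mul_eq_mul_div, lt_div_iff₀ hd] at h3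
      exact h3.le

lemma volume_ge (U : Set ℂ) (ε α σ d a b : ℝ) (hε : ε = 1 ∨ ε = -1) (hσ : σ = 1 ∨ σ = -1)
    (hd : 0 < d) (hab : a ≤ b) (hUm : MeasurableSet U)
    (hU : ∀ w ∈ tri d a b, coord ε α σ w ∈ U) :
    ENNReal.ofReal (d * (b - a) / 2) ≤ volume U := by
  rw [← volume_tri d a b hd hab, ← (mp_coord ε α σ hε hσ).measure_preimage hUm.nullMeasurableSet]
  exact measure_mono hU

/-- The conclusion of the local step. -/
def Good (U : Set ℂ) (α : ℝ) : Prop :=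
  ∃ (c : AddCircle Real.pi) (ρ : ℝ), 0 < ρ ∧ ρ ≤ Real.pi ∧
    (α : AddCircle Real.pi) ∈ closedBall c ρ ∧
    ENNReal.ofReal (ρ / 16) ≤ volume (U ∩ dirMod ⁻¹' closedBall c ρ)

lemma key (U : Set ℂ) (hUm : MeasurableSet U) (ε α σ d a b : ℝ) (hε : ε = 1 ∨ ε = -1)
    (hσ : σ = 1 ∨ σ = -1) (hd : 0 < d) (hd4 : d ≤ 1 / 4) (ha : √(1 / 16 - d ^ 2) ≤ a)
    (hab : 1 / 2 - √(1 / 16 - d ^ 2) ≤ b - a)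
    (hU : ∀ l ∈ Icc (0 : ℝ) 1, ∀ z ∈ Icc a b, coord ε α σ ((l : ℂ) * (d + z * Complex.I)) ∈ U) :
    Good U α := by
  set t := Real.arcsin (4 * d) with ht
  have hsin : Real.sin t = 4 * d := Real.sin_arcsin (by linarith) (by linarith)
  have hcos : Real.cos t = 4 * √(1 / 16 - d ^ 2) := by
    rw [ht, Real.cos_arcsin]
    rw [show 1 - (4 * d) ^ 2 = 4 ^ 2 * (1 / 16 - d ^ 2) by ring, Real.sqrt_mul (by norm_num),
      Real.sqrt_sq (by norm_num)]
  have ht0 : 0 < t := Real.arcsin_pos.2 (by linarith)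
  have ht1 : t ≤ Real.pi / 2 := Real.arcsin_le_pi_div_two _
  have hc1 := Real.cos_le_one t
  have habs : ∀ s : ℝ, 0 ≤ s → s ≤ t → ((α + σ * s : ℝ) : AddCircle Real.pi) ∈
      closedBall ((α + σ * (t / 2) : ℝ) : AddCircle Real.pi) (t / 2) := by
    intro s h0 h1
    rw [mem_closedBall, dist_eq_norm, ← AddCircle.coe_sub]
    have e : |α + σ * s - (α + σ * (t / 2))| = |s - t / 2| := by
      rw [show α + σ * s - (α + σ * (t / 2)) = σ * (s - t / 2) by ring, abs_mul]
      rcases hσ with h | h <;> simp [h]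
    have e2 : |s - t / 2| ≤ t / 2 := abs_le.2 ⟨by linarith, by linarith⟩
    rw [(AddCircle.norm_coe_eq_abs_iff Real.pi Real.pi_pos.ne').2, e]
    · exact e2
    · rw [e, abs_of_pos Real.pi_pos]
      linarith
  refine ⟨((α + σ * (t / 2) : ℝ) : AddCircle Real.pi), t / 2, by linarith,
    by linarith [Real.pi_pos], ?_, ?_⟩
  · simpa using habs 0 le_rfl ht0.le
  · have := trig_ineq t ht0.le ht1
    refine le_trans (ENNReal.ofReal_le_ofReal ?_)
      (volume_ge _ ε α σ d a b hε hσ hd (by linarith)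
        (hUm.inter (measurable_dirMod isClosed_closedBall.measurableSet)) ?_)
    · rw [hsin] at this
      nlinarith
    · intro w hw
      refine ⟨coord_tri_mem U ε α σ d a b hd hU w hw, ?_⟩
      obtain ⟨⟨h0, h1⟩, h2, h3⟩ := hw
      set v : ℂ := ⟨w.im, w.re⟩ with hv
      have hvc := Complex.norm_mul_cos_arg v
      have hvs := Complex.norm_mul_sin_arg v
      have ha0 : 0 ≤ a := (Real.sqrt_nonneg _).trans ha
      have him : 0 ≤ w.im := le_trans (by positivity) h2.le
      have hvpos : 0 < ‖v‖ := by
        rw [norm_pos_iff]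
        intro h
        have : v.im = 0 := by rw [h]; rfl
        exact h0.ne' this
      have hg0 : 0 ≤ v.arg := Complex.arg_nonneg_iff.2 h0.le
      have hg1 : v.arg ≤ Real.pi / 2 := (abs_le.1 (Complex.abs_arg_le_pi_div_two_iff.2 him)).2
      have hgt : v.arg ≤ t := by
        by_contra hlt
        push Not at hlt
        have hneg : Real.sin (t - v.arg) < 0 :=
          Real.sin_neg_of_neg_of_neg_pi_lt (by linarith) (by linarith [Real.pi_pos])
        have : 0 ≤ ‖v‖ * Real.sin (t - v.arg) := by
          rw [Real.sin_sub, hsin, hcos]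
          have e : ‖v‖ * (4 * d * Real.cos v.arg - 4 * √(1 / 16 - d ^ 2) * Real.sin v.arg)
            = 4 * (d * w.im - √(1 / 16 - d ^ 2) * w.re) := by
            have hvc' : ‖v‖ * Real.cos v.arg = w.im := hvc
            have hvs' : ‖v‖ * Real.sin v.arg = w.re := hvs
            rw [← hvc', ← hvs']
            ring
          rw [e]
          rw [div_mul_eq_mul_div, div_lt_iff₀ hd] at h2
          nlinarith
        nlinarith
      rw [mem_preimage]
      rw [dirMod_coord ε α σ hε hσ ‖v‖ v.arg hvpos w hvc.symm hvs.symm]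
      exact habs _ hg0 hgt

lemma good_of_big (U : Set ℂ) (α : ℝ) (h : ENNReal.ofReal (1 / 8) ≤ volume U) : Good U α := by
  have hu : closedBall (α : AddCircle Real.pi) (Real.pi / 2) = univ :=
    AddCircle.closedBall_eq_univ_of_half_period_le _ Real.pi_pos.ne' _
      (by rw [abs_of_pos Real.pi_pos])
  refine ⟨α, Real.pi / 2, by positivity, by linarith [Real.pi_pos], ?_, ?_⟩
  · rw [hu]; trivial
  · rw [hu, preimage_univ, inter_univ]
    refine le_trans (ENNReal.ofReal_le_ofReal ?_) h
    linarith [Real.pi_lt_four]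

/-- Every direction is good. -/
lemma good_dir (E U : Set ℂ) (hEU : E ⊆ U) (hUo : IsOpen U) (α : ℝ)
    (hstar : ∀ x ∈ E, ∀ l ∈ Icc (0 : ℝ) 1, (l : ℂ) * x ∈ E) (p : ℂ)
    (hp : ∀ s ∈ Icc (0 : ℝ) 1, p + s * ((Real.cos α : ℂ) + (Real.sin α : ℂ) * Complex.I) ∈ E) :
    Good U α := by
  have hcs : (Complex.cos α) ^ 2 + (Complex.sin α) ^ 2 = 1 := Complex.cos_sq_add_sin_sq _
  -- coordinates of `p`
  obtain ⟨z0, y0, hpz⟩ : ∃ z0 y0 : ℝ, p = ((Real.cos α : ℂ) + (Real.sin α : ℂ) * Complex.I) *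
      ((z0 : ℂ) + y0 * Complex.I) := by
    refine ⟨p.re * Real.cos α + p.im * Real.sin α, p.im * Real.cos α - p.re * Real.sin α, ?_⟩
    conv_lhs => rw [← Complex.re_add_im p]
    push_cast
    linear_combination (-(p.re : ℂ) - p.im * Complex.I) * hcs +
      (-Complex.sin α * (p.im * Complex.cos α - p.re * Complex.sin α)) * Complex.I_sq
  -- choose the sign
  obtain ⟨ε, z1, y1, hε, hz1, hseg⟩ : ∃ ε z1 y1 : ℝ, (ε = 1 ∨ ε = -1) ∧ -(1 / 2) ≤ z1 ∧
      ∀ z ∈ Icc z1 (z1 + 1), (ε : ℂ) * ((Real.cos α : ℂ) + (Real.sin α : ℂ) * Complex.I) *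
      ((z : ℂ) + y1 * Complex.I) ∈ E := by
    by_cases h : -(1 / 2) ≤ z0
    · refine ⟨1, z0, y0, Or.inl rfl, h, ?_⟩
      intro z hz
      have := hp (z - z0) ⟨by linarith [hz.1], by linarith [hz.2]⟩
      convert this using 1
      rw [hpz]
      push_cast
      ring
    · refine ⟨-1, -z0 - 1, -y0, Or.inr rfl, by linarith, ?_⟩
      intro z hz
      have := hp (-z - z0) ⟨by linarith [hz.2], by linarith [hz.1]⟩
      convert this using 1
      rw [hpz]
      push_cast
      ring
  obtain ⟨σ, d, hσ, hd0, hy1⟩ : ∃ σ d : ℝ, (σ = 1 ∨ σ = -1) ∧ 0 ≤ d ∧ y1 = σ * d := by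
    rcases le_total 0 y1 with h | h
    · exact ⟨1, y1, Or.inl rfl, h, by ring⟩
    · exact ⟨-1, -y1, Or.inr rfl, by linarith, by ring⟩
  have hcone : ∀ l ∈ Icc (0 : ℝ) 1, ∀ z ∈ Icc z1 (z1 + 1),
      coord ε α σ ((l : ℂ) * (d + z * Complex.I)) ∈ E := by
    intro l hl z hz
    have := hstar _ (hseg z hz) l hl
    convert this using 1
    simp only [coord, hy1]
    simp
    ring
  rcases hd0.eq_or_lt with h0 | hdpos
  · -- degenerate case
    have hcont : Continuous (coord ε α σ) := by unfold coord; fun_prop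
    have hK : IsCompact ((fun z : ℝ => (z : ℂ) * Complex.I) '' Icc 0 (1 / 2)) :=
      isCompact_Icc.image (by fun_prop)
    obtain ⟨δ, hδ, hth⟩ := hK.exists_thickening_subset_open (hUo.preimage hcont) (by
      rintro _ ⟨z, hz, rfl⟩
      apply hEU
      by_cases hzz : z1 ≤ z
      · have := hcone 1 ⟨zero_le_one, le_rfl⟩ z ⟨hzz, by linarith [hz.2]⟩
        simpa [← h0] using this
      · have hz1p : 0 < z1 := by linarith [hz.1]
        have := hcone (z / z1) ⟨div_nonneg hz.1 hz1p.le, (div_le_one hz1p).2 (by linarith)⟩ z1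
          ⟨le_rfl, by linarith⟩
        convert this using 2
        rw [← h0]
        have : (z1 : ℂ) ≠ 0 := by exact_mod_cast hz1p.ne'
        push_cast
        field_simp
        ring)
    set d' := min (δ / 2) (1 / 4) with hd'
    have hd'0 : 0 < d' := lt_min (by linarith) (by norm_num)
    have hsq := Real.sqrt_nonneg (1 / 16 - d' ^ 2)
    refine key U hUo.measurableSet ε α σ d' (√(1 / 16 - d' ^ 2)) (1 / 2) hε hσ hd'0
      (min_le_right _ _) le_rfl le_rfl ?_
    intro l hl z hz
    apply hth
    rw [mem_thickening_iff]
    refine ⟨((l * z : ℝ) : ℂ) * Complex.I, ⟨l * z, ⟨mul_nonneg hl.1 (hsq.trans hz.1), ?_⟩, rfl⟩, ?_⟩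
    · nlinarith [hl.1, hl.2, hz.1, hz.2]
    · rw [dist_eq_norm]
      have : (l : ℂ) * (d' + z * Complex.I) - ((l * z : ℝ) : ℂ) * Complex.I = ((l * d' : ℝ) : ℂ) := by
        push_cast
        ring
      rw [this, Complex.norm_real, Real.norm_of_nonneg (mul_nonneg hl.1 hd'0.le)]
      have := min_le_left (δ / 2) (1 / 4)
      nlinarith [hl.1, hl.2]
  · by_cases hd4 : d ≤ 1 / 4
    · have hs4 : √(1 / 16 - d ^ 2) ≤ 1 / 4 := by
        rw [Real.sqrt_le_left (by norm_num)]
        nlinarith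
      refine key U hUo.measurableSet ε α σ d (max z1 (√(1 / 16 - d ^ 2))) (z1 + 1) hε hσ hdpos hd4
        (le_max_right _ _) ?_ ?_
      · rcases max_cases z1 (√(1 / 16 - d ^ 2)) with h | h
        · rw [h.1]
          linarith [Real.sqrt_nonneg (1 / 16 - d ^ 2)]
        · rw [h.1]
          linarith
      · intro l hl z hz
        exact hEU (hcone l hl z ⟨(le_max_left _ _).trans hz.1, hz.2⟩)
    · apply good_of_big
      refine le_trans (ENNReal.ofReal_le_ofReal ?_) (volume_ge U ε α σ d z1 (z1 + 1) hε hσ hdpos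
        (by linarith) hUo.measurableSet (coord_tri_mem U ε α σ d z1 (z1 + 1) hdpos
          (fun l hl z hz => hEU (hcone l hl z hz))))
      push Not at hd4
      linarith

/-- The covering argument. -/
lemma volume_of_good (U : Set ℂ) (hU : MeasurableSet U) (h : ∀ α ∈ Ico 0 Real.pi, Good U α) :
    ENNReal.ofReal (Real.pi / 108) ≤ volume U := by
  have hall : ∀ a : AddCircle Real.pi, ∃ (c : AddCircle Real.pi) (ρ : ℝ), 0 < ρ ∧ ρ ≤ Real.pi ∧
      a ∈ closedBall c ρ ∧ ENNReal.ofReal (ρ / 16) ≤ volume (U ∩ dirMod ⁻¹' closedBall c ρ) := by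
    intro a
    obtain ⟨α, hα, rfl⟩ : ∃ α ∈ Ico 0 (0 + Real.pi), (α : AddCircle Real.pi) = a := by
      have := AddCircle.coe_image_Ico_eq Real.pi 0
      exact (this.symm ▸ mem_univ a : a ∈ _ '' _)
    rw [zero_add] at hα
    exact h α hα
  choose c ρ hρ hρπ hmem hvol using hall
  obtain ⟨u, -, hdisj, hcov⟩ := Vitali.exists_disjoint_subfamily_covering_enlargement_closedBall
    univ c ρ Real.pi (fun a _ => hρπ a) (27 / 8) (by norm_num)
  have hcount : u.Countable := by
    apply hdisj.countable_of_nonempty_interior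
    intro a _
    exact ⟨c a, ball_subset_interior_closedBall (mem_ball_self (hρ a))⟩
  have h1 : ENNReal.ofReal Real.pi ≤ ∑' b : u, ENNReal.ofReal (27 / 4 * ρ b) := by
    rw [← AddCircle.measure_univ Real.pi]
    calc volume (univ : Set (AddCircle Real.pi))
        ≤ volume (⋃ b ∈ u, closedBall (c b) (27 / 8 * ρ b)) := by
          apply measure_mono
          intro a _
          obtain ⟨b, hb, hsub⟩ := hcov a (mem_univ a)
          exact mem_biUnion hb (hsub (hmem a))
      _ ≤ ∑' b : u, volume (closedBall (c b) (27 / 8 * ρ b)) := measure_biUnion_le _ hcount _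
      _ ≤ _ := by
          apply ENNReal.tsum_le_tsum
          intro b
          rw [AddCircle.volume_closedBall]
          apply ENNReal.ofReal_le_ofReal
          refine (min_le_right _ _).trans (le_of_eq (by ring))
  have h2 : ∑' b : u, ENNReal.ofReal (ρ b / 16) ≤ volume U := by
    calc _ ≤ ∑' b : u, volume (U ∩ dirMod ⁻¹' closedBall (c b) (ρ b)) :=
          ENNReal.tsum_le_tsum (fun b => hvol b)
      _ = volume (⋃ b ∈ u, U ∩ dirMod ⁻¹' closedBall (c b) (ρ b)) := by
          rw [measure_biUnion hcount]
          · intro a ha b hb hab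
            exact ((hdisj ha hb hab).preimage dirMod).mono inter_subset_right inter_subset_right
          · intro b _
            exact hU.inter (measurable_dirMod isClosed_closedBall.measurableSet)
      _ ≤ volume U := measure_mono (iUnion₂_subset fun b _ => inter_subset_left)
  have h3 : ∑' b : u, ENNReal.ofReal (27 / 4 * ρ b) =
      ENNReal.ofReal 108 * ∑' b : u, ENNReal.ofReal (ρ b / 16) := by
    rw [← ENNReal.tsum_mul_left]
    congr 1
    ext b
    rw [← ENNReal.ofReal_mul (by norm_num)]
    congr 1
    ring
  rw [ENNReal.ofReal_div_of_pos (by norm_num)]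
  apply ENNReal.div_le_of_le_mul'
  calc _ ≤ _ := h1
    _ = _ := h3
    _ ≤ _ := by gcongr

end StarKakeya

/-- Cunningham's bound: every star-shaped Kakeya set `E ⊂ ℝ²` (star-shaped about some
point `O ∈ E`, containing a unit segment in every direction `α ∈ [0,π)`) satisfies
`ℒ₂*(E) ≥ π/108`. -/
theorem starshaped_kakeya_cunningham (E : Set (EuclideanSpace ℝ (Fin 2)))
    (O : EuclideanSpace ℝ (Fin 2)) (hO : O ∈ E)
    (hstar : ∀ x ∈ E, segment ℝ O x ⊆ E)
    (hkakeya : ∀ α ∈ Set.Ico 0 Real.pi,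
      ∃ p : EuclideanSpace ℝ (Fin 2), segment ℝ p (p + dirVec α) ⊆ E) :
    ENNReal.ofReal (Real.pi / 108) ≤ volume E := by
  rw [Set.measure_eq_iInf_isOpen]
  refine le_iInf fun U => le_iInf fun hEU => le_iInf fun hUo => ?_
  set e := Complex.orthonormalBasisOneI.repr with he
  set g : ℂ → EuclideanSpace ℝ (Fin 2) := fun w => O + e w with hg
  have hgm : MeasurePreserving g volume volume :=
    (measurePreserving_add_left volume O).comp e.measurePreserving
  have hgc : Continuous g := continuous_const.add e.continuous
  rw [← hgm.measure_preimage hUo.measurableSet.nullMeasurableSet]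
  have hUo' := hUo.preimage hgc
  apply StarKakeya.volume_of_good _ hUo'.measurableSet
  intro α hα
  obtain ⟨p, hp⟩ := hkakeya α hα
  have hdir : e ((Real.cos α : ℂ) + (Real.sin α : ℂ) * Complex.I) = dirVec α := by
    ext i
    rw [he, Complex.orthonormalBasisOneI_repr_apply]
    fin_cases i
    · simp [dirVec, -Complex.ofReal_cos, -Complex.ofReal_sin]
    · simp [dirVec, -Complex.ofReal_cos, -Complex.ofReal_sin]
  refine StarKakeya.good_dir (g ⁻¹' E) (g ⁻¹' U) (preimage_mono hEU) hUo' α ?_ (e.symm (p - O)) ?_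
  · intro x hx l hl
    apply hstar _ hx
    rw [segment_eq_image']
    refine ⟨l, hl, ?_⟩
    simp only [hg, add_sub_cancel_left]
    rw [← Complex.real_smul, map_smul]
  · intro s hs
    apply hp
    rw [segment_eq_image']
    refine ⟨s, hs, ?_⟩
    simp only [hg, add_sub_cancel_left]
    rw [← Complex.real_smul, map_add, map_smul, hdir, e.apply_symm_apply]
    abel
end

section
/- Every star-shaped Kakeya set E ⊂ ℝ² satisfies ℒ₂*(E) ≥ π/98. -/
open MeasureTheory Metric Set

/-- Vitali covering step on the circle of directions. -/
lemma kk_vitali (V : Set ℂ) (hV : MeasurableSet V) (c : ℝ) (hc : 0 < c)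
    (x : AddCircle (2 * Real.pi) → AddCircle (2 * Real.pi)) (r : AddCircle (2 * Real.pi) → ℝ)
    (hr0 : ∀ a, 0 < r a) (hr1 : ∀ a, r a ≤ 1) (hmem : ∀ a, a ∈ closedBall (x a) (r a))
    (harea : ∀ a, ENNReal.ofReal (c * (2 * r a)) ≤
      volume (V ∩ {z : ℂ | ((Complex.arg z : ℝ) : AddCircle (2 * Real.pi)) ∈
        closedBall (x a) (r a)})) :
    ENNReal.ofReal (2 * Real.pi * c / 3.02) ≤ volume V := by
  have : Fact (0 < 2 * Real.pi) := ⟨Real.two_pi_pos⟩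
  obtain ⟨u, -, hdisj, hcov⟩ := Vitali.exists_disjoint_subfamily_covering_enlargement
    (fun a => closedBall (x a) (r a)) univ r 1.01 (by norm_num) (fun a _ => (hr0 a).le) 1
    (fun a _ => hr1 a) (fun a _ => ⟨a, hmem a⟩)
  have hcount : u.Countable := hdisj.countable_of_nonempty_interior (fun a _ =>
    ⟨x a, ball_subset_interior_closedBall (mem_ball_self (hr0 a))⟩)
  have := hcount.to_subtype
  have hcov' : (univ : Set (AddCircle (2 * Real.pi))) ⊆
      ⋃ b : u, closedBall (x b) (3.02 * r b) := by
    intro a _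
    obtain ⟨b, hb, ⟨y, hy1, hy2⟩, hle⟩ := hcov a (mem_univ a)
    refine mem_iUnion.2 ⟨⟨b, hb⟩, ?_⟩
    have h1 := mem_closedBall.1 (hmem a)
    have h2 := mem_closedBall.1 hy1
    have h3 := mem_closedBall.1 hy2
    have h4 : dist a (x b) ≤ dist a (x a) + dist (x a) y + dist y (x b) := dist_triangle4 _ _ _ _
    rw [dist_comm (x a) y] at h4
    rw [mem_closedBall]
    show dist a (x b) ≤ 3.02 * r b
    linarith
  have hsum : ∑' b : u, volume (V ∩ {z : ℂ | ((Complex.arg z : ℝ) : AddCircle (2 * Real.pi)) ∈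
        closedBall (x b) (r b)}) ≤ volume V := by
    refine (tsum_meas_le_meas_iUnion_of_disjoint volume ?_ ?_).trans
      (measure_mono (iUnion_subset fun b => inter_subset_left))
    · intro b
      refine hV.inter ?_
      have hm : Measurable (fun z : ℂ => ((Complex.arg z : ℝ) : AddCircle (2 * Real.pi))) :=
        (AddCircle.measurable_mk' (a := 2 * Real.pi)).comp Complex.measurable_arg
      exact hm isClosed_closedBall.measurableSet
    · intro a b hab
      have := hdisj a.2 b.2 (fun h => hab (Subtype.ext h))
      refine Set.disjoint_left.2 ?_
      rintro z ⟨_, hz1⟩ ⟨_, hz2⟩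
      exact Set.disjoint_left.1 this hz1 hz2
  have hU : ENNReal.ofReal (2 * Real.pi) ≤ ∑' b : u, ENNReal.ofReal (3.02 * (2 * r b)) := by
    calc ENNReal.ofReal (2 * Real.pi) = volume (univ : Set (AddCircle (2 * Real.pi))) :=
          (AddCircle.measure_univ _).symm
      _ ≤ volume (⋃ b : u, closedBall (x b) (3.02 * r b)) := measure_mono hcov'
      _ ≤ ∑' b : u, volume (closedBall (x b) (3.02 * r b)) := measure_iUnion_le _
      _ ≤ _ := by
        refine ENNReal.tsum_le_tsum fun b => ?_
        rw [AddCircle.volume_closedBall]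
        refine ENNReal.ofReal_le_ofReal ((min_le_right _ _).trans (le_of_eq (by ring)))
  calc ENNReal.ofReal (2 * Real.pi * c / 3.02)
      = ENNReal.ofReal (c / 3.02) * ENNReal.ofReal (2 * Real.pi) := by
        rw [← ENNReal.ofReal_mul (by positivity)]; congr 1; ring
    _ ≤ ENNReal.ofReal (c / 3.02) * ∑' b : u, ENNReal.ofReal (3.02 * (2 * r b)) := by gcongr
    _ = ∑' b : u, ENNReal.ofReal (c * (2 * r b)) := by
        rw [← ENNReal.tsum_mul_left]
        congr 1; ext b
        rw [← ENNReal.ofReal_mul (by positivity)]; congr 1; ring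
    _ ≤ _ := (ENNReal.tsum_le_tsum fun b : u => harea b.1).trans hsum

/-- Area of the standard triangle. -/
lemma kk_std : volume {p : ℝ × ℝ | 0 < p.1 ∧ p.1 < 1 ∧ 0 < p.2 ∧ p.2 < 1 - p.1} =
    ENNReal.ofReal (1 / 2) := by
  have h : {p : ℝ × ℝ | 0 < p.1 ∧ p.1 < 1 ∧ 0 < p.2 ∧ p.2 < 1 - p.1} =
      regionBetween (fun _ => (0 : ℝ)) (fun x => 1 - x) (Ioc 0 1) := by
    ext p
    simp only [regionBetween, mem_ofPred_eq, mem_Ioc, mem_Ioo]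
    constructor
    · rintro ⟨h1, h2, h3, h4⟩; exact ⟨⟨h1, h2.le⟩, h3, h4⟩
    · rintro ⟨⟨h1, h2⟩, h3, h4⟩; exact ⟨h1, by linarith, h3, h4⟩
  rw [h, Measure.volume_eq_prod, volume_regionBetween_eq_integral]
  · congr 1
    rw [← intervalIntegral.integral_of_le zero_le_one]
    simp only [Pi.sub_apply, sub_zero]
    rw [intervalIntegral.integral_sub (by simp) (by simp)]
    simp; norm_num
  · exact (continuous_const.integrableOn_Icc).mono_set Ioc_subset_Icc_self
  · exact (Continuous.integrableOn_Icc (by fun_prop)).mono_set Ioc_subset_Icc_self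
  · exact measurableSet_Ioc
  · intro x hx; show (0 : ℝ) ≤ 1 - x; linarith [hx.2]

/-- Lower bound for the area of the triangle with vertices `0`, `P`, `Q`. -/
lemma kk_tri (P Q : ℂ) (S : Set ℂ)
    (hS : ∀ a b : ℝ, 0 < a → 0 < b → a + b ≤ 1 → (a : ℂ) * P + (b : ℂ) * Q ∈ S) :
    ENNReal.ofReal (|P.re * Q.im - Q.re * P.im| / 2) ≤ volume S := by
  rw [← Complex.volume_preserving_equiv_real_prod.symm.measure_preimage_equiv S]
  set L := Matrix.toLin (Module.Basis.finTwoProd ℝ) (Module.Basis.finTwoProd ℝ)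
    !![P.re, Q.re; P.im, Q.im] with hL
  have hsub : L '' {p : ℝ × ℝ | 0 < p.1 ∧ p.1 < 1 ∧ 0 < p.2 ∧ p.2 < 1 - p.1} ⊆
      Complex.measurableEquivRealProd.symm ⁻¹' S := by
    rintro _ ⟨⟨a, b⟩, ⟨h1, h2, h3, h4⟩, rfl⟩
    have := hS a b h1 h3 (by simp only at h4; linarith)
    rw [hL, Matrix.toLin_finTwoProd_apply, mem_preimage,
      Complex.measurableEquivRealProd_symm_apply]
    convert this using 1
    apply Complex.ext <;> simp <;> ring
  refine le_trans (le_of_eq ?_) (measure_mono hsub)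
  rw [Measure.addHaar_image_linearMap, kk_std, hL, LinearMap.det_toLin, Matrix.det_fin_two_of,
    ← ENNReal.ofReal_mul (abs_nonneg _)]
  congr 1; ring

lemma kk_arctan (x : ℝ) : |Real.arctan x| ≤ |x| := by
  have key : ∀ y : ℝ, 0 ≤ y → Real.arctan y ≤ y := fun y hy => by
    have := Real.le_tan (Real.arctan_nonneg.2 hy) (Real.arctan_lt_pi_div_two y)
    rwa [Real.tan_arctan] at this
  rcases le_total 0 x with h | h
  · rw [abs_of_nonneg h, abs_of_nonneg (Real.arctan_nonneg.2 h)]; exact key x h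
  · have := key (-x) (by linarith)
    rw [Real.arctan_neg] at this
    rw [abs_of_nonpos h, abs_of_nonpos (by simpa using h)]; exact this

lemma kk_arg (α x y : ℝ) (hx : 0 < x) :
    ((Complex.arg (Complex.exp (α * Complex.I) * (x + y * Complex.I)) : ℝ) : Real.Angle) =
      ((α + Real.arctan (y / x) : ℝ) : Real.Angle) := by
  set φ := Real.arctan (y / x) with hφ
  have hcos : 0 < Real.cos φ := Real.cos_arctan_pos _
  have htan : Real.sin φ = y / x * Real.cos φ := by
    have := Real.tan_arctan (y / x)
    rw [← hφ, Real.tan_eq_sin_div_cos] at this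
    field_simp at this ⊢
    linarith
  have : Complex.exp (α * Complex.I) * (x + y * Complex.I) =
      ((x / Real.cos φ : ℝ) : ℂ) * (Real.cos ((α + φ : ℝ)) + Real.sin ((α + φ : ℝ)) * Complex.I) := by
    rw [Complex.exp_mul_I, ← Complex.ofReal_cos, ← Complex.ofReal_sin, Real.cos_add, Real.sin_add,
      htan]
    apply Complex.ext <;>
      simp [-Complex.ofReal_cos, -Complex.ofReal_sin, -Complex.ofReal_div] <;> field_simp <;> ring
  rw [this]
  have h2 := Complex.arg_mul_cos_add_sin_mul_I_coe_angle (r := x / Real.cos φ) (by positivity)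
    ((α + φ : ℝ) : Real.Angle)
  rwa [Real.Angle.cos_coe, Real.Angle.sin_coe] at h2

/-- One direction: a suitable triangle gives a good sector. -/
lemma kk_sector (V : Set ℂ) (α h τ T : ℝ) (hh : h ≠ 0) (hτ : 0 < τ) (hT : 1 / 16 ≤ τ * (T - τ))
    (hin : ∀ a b : ℝ, 0 < a → 0 < b → a + b ≤ 1 → Complex.exp (α * Complex.I) *
      (((a * τ + b * T : ℝ) : ℂ) + (((a + b) * h : ℝ) : ℂ) * Complex.I) ∈ V) :
    ∃ (x : AddCircle (2 * Real.pi)) (r : ℝ), 0 < r ∧ r ≤ 1 ∧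
      (α : AddCircle (2 * Real.pi)) ∈ closedBall x r ∧
      ENNReal.ofReal (1 / 32 * (2 * r)) ≤
      volume (V ∩ {z : ℂ | ((Complex.arg z : ℝ) : AddCircle (2 * Real.pi)) ∈
        closedBall x r}) := by
  have hTτ : 0 < T - τ := by
    by_contra hcon
    have : τ * (T - τ) ≤ 0 := mul_nonpos_of_nonneg_of_nonpos hτ.le (not_lt.1 hcon)
    linarith
  set A := Real.arctan (h / τ) with hA
  have hA0 : A ≠ 0 := by
    rw [hA, Ne, Real.arctan_eq_zero_iff]; exact div_ne_zero hh hτ.ne'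
  have hA1 : |A| ≤ 2 := by
    have h1 := Real.arctan_lt_pi_div_two (h / τ)
    have h2 := Real.neg_pi_div_two_lt_arctan (h / τ)
    have := Real.pi_le_four
    rw [abs_le]; constructor <;> linarith
  have hball : ∀ φ : ℝ, |φ - A / 2| ≤ |A| / 2 → ((α + φ : ℝ) : AddCircle (2 * Real.pi)) ∈
      closedBall ((α + A / 2 : ℝ) : AddCircle (2 * Real.pi)) (|A| / 2) := by
    intro φ hφ
    rw [mem_closedBall, dist_eq_norm, ← AddCircle.coe_sub]
    refine (QuotientAddGroup.norm_mk_le_norm).trans ?_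
    rw [Real.norm_eq_abs]
    have e : α + φ - (α + A / 2) = φ - A / 2 := by ring
    rw [e]; exact hφ
  refine ⟨((α + A / 2 : ℝ) : AddCircle (2 * Real.pi)), |A| / 2, by positivity, by linarith, ?_, ?_⟩
  · have := hball 0 (by rw [zero_sub, abs_neg, abs_div, abs_two])
    rwa [add_zero] at this
  · set u := Complex.exp (α * Complex.I) with hu
    refine le_trans ?_ (kk_tri (u * ((τ : ℂ) + h * Complex.I)) (u * ((T : ℂ) + h * Complex.I)) _ ?_)
    · apply ENNReal.ofReal_le_ofReal
      have hdet : (u * ((τ : ℂ) + h * Complex.I)).re * (u * ((T : ℂ) + h * Complex.I)).im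
          - (u * ((T : ℂ) + h * Complex.I)).re * (u * ((τ : ℂ) + h * Complex.I)).im =
          -(h * (T - τ)) := by
        rw [hu, Complex.exp_mul_I, ← Complex.ofReal_cos, ← Complex.ofReal_sin]
        simp [-Complex.ofReal_cos, -Complex.ofReal_sin]
        linear_combination (-(h * (T - τ))) * Real.sin_sq_add_cos_sq α
      rw [hdet, abs_neg, abs_mul, abs_of_pos hTτ]
      have h1 := kk_arctan (h / τ)
      rw [← hA, abs_div, abs_of_pos hτ] at h1
      have h2 : |A| * τ ≤ |h| := (le_div_iff₀ hτ).1 h1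
      have h3 : |A| * (1 / 16) ≤ |A| * (τ * (T - τ)) := by gcongr
      have h4 : |A| * τ * (T - τ) ≤ |h| * (T - τ) := by gcongr
      linarith
    · intro a b ha hb hab
      have e : (a : ℂ) * (u * ((τ : ℂ) + h * Complex.I)) + (b : ℂ) * (u * ((T : ℂ) + h * Complex.I))
          = u * (((a * τ + b * T : ℝ) : ℂ) + (((a + b) * h : ℝ) : ℂ) * Complex.I) := by
        push_cast; ring
      rw [e]
      refine ⟨hin a b ha hb hab, ?_⟩
      have hx : 0 < a * τ + b * T := by
        have : 0 < T := by linarith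
        positivity
      have hang := kk_arg α (a * τ + b * T) ((a + b) * h) hx
      rw [mem_ofPred_eq]
      change ((Complex.arg _ : ℝ) : Real.Angle) ∈ _
      rw [hang]
      apply hball
      set q := (a + b) * h / (a * τ + b * T) with hq
      have hq' : q = h / τ * ((a + b) * τ / (a * τ + b * T)) := by
        rw [hq]; field_simp
      have hs0 : 0 ≤ (a + b) * τ / (a * τ + b * T) := by positivity
      have hs1 : (a + b) * τ / (a * τ + b * T) ≤ 1 := by
        rw [div_le_one hx]
        nlinarith
      rcases lt_or_gt_of_ne hh with hneg | hpos
      · have hd : h / τ < 0 := div_neg_of_neg_of_pos hneg hτ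
        have q1 : q ≤ 0 := by rw [hq']; nlinarith
        have q2 : h / τ ≤ q := by rw [hq']; nlinarith
        have b1 : Real.arctan q ≤ 0 := by simpa using q1
        have b2 : A ≤ Real.arctan q := Real.arctan_mono q2
        rw [abs_of_nonpos (b2.trans b1), abs_le]; constructor <;> linarith
      · have hd : 0 < h / τ := div_pos hpos hτ
        have q1 : 0 ≤ q := by rw [hq']; positivity
        have q2 : q ≤ h / τ := by rw [hq']; nlinarith
        have b1 : 0 ≤ Real.arctan q := Real.arctan_nonneg.2 q1
        have b2 : Real.arctan q ≤ A := Real.arctan_mono q2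
        rw [abs_of_nonneg (b1.trans b2), abs_le]; constructor <;> linarith

/-- A star-shaped set containing a unit segment, position normalised. -/
lemma kk_dir (F V : Set ℂ) (hFV : F ⊆ V) (hV : IsOpen V) (h0 : (0 : ℂ) ∈ F)
    (hstar : ∀ x ∈ F, ∀ s : ℝ, 0 ≤ s → s ≤ 1 → (s : ℂ) * x ∈ F)
    (α t h : ℝ) (ht : -1 / 2 ≤ t)
    (hseg : ∀ τ : ℝ, t ≤ τ → τ ≤ t + 1 →
      Complex.exp (α * Complex.I) * ((τ : ℂ) + h * Complex.I) ∈ F) :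
    ∃ (x : AddCircle (2 * Real.pi)) (r : ℝ), 0 < r ∧ r ≤ 1 ∧
      (α : AddCircle (2 * Real.pi)) ∈ closedBall x r ∧
      ENNReal.ofReal (1 / 32 * (2 * r)) ≤
      volume (V ∩ {z : ℂ | ((Complex.arg z : ℝ) : AddCircle (2 * Real.pi)) ∈
        closedBall x r}) := by
  set u := Complex.exp (α * Complex.I) with hu
  by_cases hh : h = 0
  · subst hh
    have hK : IsCompact ((fun s : ℝ => u * (s : ℂ)) '' Icc 0 (1 / 2)) :=
      isCompact_Icc.image (by fun_prop)
    have hKV : ((fun s : ℝ => u * (s : ℂ)) '' Icc 0 (1 / 2)) ⊆ V := by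
      rintro _ ⟨s, ⟨hs0, hs1⟩, rfl⟩
      apply hFV
      have ht1 : 0 < t + 1 := by linarith
      have := hstar _ (hseg (t + 1) (by linarith) le_rfl) (s / (t + 1)) (by positivity)
        (by rw [div_le_one ht1]; linarith)
      convert this using 1
      have : ((t : ℂ) + 1) ≠ 0 := by exact_mod_cast ht1.ne'
      push_cast
      field_simp
      ring
    obtain ⟨δ, hδ, hsub⟩ := hK.exists_thickening_subset_open hV hKV
    refine kk_sector V α (δ / 2) (1 / 4) (1 / 2) (by positivity) (by norm_num) (by norm_num) ?_
    intro a b ha hb hab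
    apply hsub
    rw [mem_thickening_iff]
    refine ⟨_, ⟨a * (1 / 4) + b * (1 / 2), ⟨by positivity, by linarith⟩, rfl⟩, ?_⟩
    rw [dist_eq_norm, ← hu]
    have : u * (((a * (1 / 4) + b * (1 / 2) : ℝ) : ℂ) + (((a + b) * (δ / 2) : ℝ) : ℂ) * Complex.I)
        - u * ((a * (1 / 4) + b * (1 / 2) : ℝ) : ℂ) =
        u * ((((a + b) * (δ / 2) : ℝ) : ℂ) * Complex.I) := by ring
    simp only [this]
    rw [norm_mul, norm_mul, Complex.norm_I, hu, Complex.norm_exp_ofReal_mul_I, Complex.norm_real,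
      Real.norm_eq_abs, abs_of_pos (by positivity)]
    nlinarith
  · have main : ∀ τ T : ℝ, t ≤ τ → τ ≤ T → T ≤ t + 1 → ∀ a b : ℝ, 0 < a → 0 < b → a + b ≤ 1 →
        u * (((a * τ + b * T : ℝ) : ℂ) + (((a + b) * h : ℝ) : ℂ) * Complex.I) ∈ V := by
      intro τ T h1 h2 h3 a b ha hb hab
      apply hFV
      have hab0 : 0 < a + b := by positivity
      have := hstar _ (hseg ((a * τ + b * T) / (a + b))
        (by rw [le_div_iff₀ hab0]; nlinarith) (by rw [div_le_iff₀ hab0]; nlinarith)) (a + b)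
        hab0.le hab
      convert this using 1
      have : ((a : ℂ) + b) ≠ 0 := by exact_mod_cast hab0.ne'
      push_cast
      field_simp
    rcases le_total t (1 / 4) with h4 | h4
    · exact kk_sector V α h (1 / 4) (1 / 2) hh (by norm_num) (by norm_num)
        (main _ _ h4 (by norm_num) (by linarith))
    · exact kk_sector V α h t (t + 1) hh (by linarith) (by linarith)
        (main _ _ le_rfl (by linarith) le_rfl)

/-- Normalisation of the position of a unit segment. -/
lemma kk_norm (E : Set ℂ) (α : ℝ) (p : ℂ)
    (hp : ∀ s : ℝ, 0 ≤ s → s ≤ 1 → p + (s : ℂ) * Complex.exp (α * Complex.I) ∈ E) :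
    ∃ t h : ℝ, -1 / 2 ≤ t ∧ ∀ τ : ℝ, t ≤ τ → τ ≤ t + 1 →
      Complex.exp (α * Complex.I) * ((τ : ℂ) + h * Complex.I) ∈ E ∪ -E := by
  set u := Complex.exp (α * Complex.I) with hu
  have hu0 : u ≠ 0 := Complex.exp_ne_zero _
  obtain ⟨t, h, hth⟩ : ∃ t h : ℝ, p = u * ((t : ℂ) + h * Complex.I) :=
    ⟨(p / u).re, (p / u).im, by rw [Complex.re_add_im]; field_simp⟩
  have hE : ∀ τ : ℝ, t ≤ τ → τ ≤ t + 1 → u * ((τ : ℂ) + h * Complex.I) ∈ E := by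
    intro τ h1 h2
    have := hp (τ - t) (by linarith) (by linarith)
    convert this using 1
    rw [hth]; push_cast; ring
  rcases le_total (-1 / 2) t with h1 | h1
  · exact ⟨t, h, h1, fun τ a b => Or.inl (hE τ a b)⟩
  · refine ⟨-t - 1, -h, by linarith, fun τ a b => Or.inr ?_⟩
    rw [Set.mem_neg]
    have := hE (-τ) (by linarith) (by linarith)
    convert this using 1
    push_cast; ring

lemma kk_complex (E : Set ℂ) (h0 : (0 : ℂ) ∈ E)
    (hstar : ∀ x ∈ E, ∀ s : ℝ, 0 ≤ s → s ≤ 1 → (s : ℂ) * x ∈ E)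
    (hk : ∀ α ∈ Set.Ico 0 Real.pi, ∃ p : ℂ, ∀ s : ℝ, 0 ≤ s → s ≤ 1 →
      p + (s : ℂ) * Complex.exp (α * Complex.I) ∈ E) :
    ENNReal.ofReal (Real.pi / 98) ≤ volume E := by
  rw [Set.measure_eq_iInf_isOpen]
  refine le_iInf₂ fun U hEU => le_iInf fun hU => ?_
  set F := E ∪ -E with hF
  set V := U ∪ -U with hVdef
  have hFV : F ⊆ V := union_subset_union hEU (Set.neg_subset_neg.2 hEU)
  have hVo : IsOpen V := hU.union hU.neg
  have hF0 : (0 : ℂ) ∈ F := Or.inl h0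
  have hFneg : ∀ z ∈ F, -z ∈ F := by
    rintro z (hz | hz)
    · exact Or.inr (by simpa using hz)
    · exact Or.inl hz
  have hFstar : ∀ x ∈ F, ∀ s : ℝ, 0 ≤ s → s ≤ 1 → (s : ℂ) * x ∈ F := by
    rintro x (hx | hx) s hs0 hs1
    · exact Or.inl (hstar x hx s hs0 hs1)
    · refine Or.inr ?_
      rw [Set.mem_neg] at hx ⊢
      have := hstar _ hx s hs0 hs1
      rwa [mul_neg] at this
  have hdir : ∀ a : AddCircle (2 * Real.pi), ∃ (x : AddCircle (2 * Real.pi)) (r : ℝ),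
      0 < r ∧ r ≤ 1 ∧ a ∈ closedBall x r ∧
      ENNReal.ofReal (1 / 32 * (2 * r)) ≤
      volume (V ∩ {z : ℂ | ((Complex.arg z : ℝ) : AddCircle (2 * Real.pi)) ∈
        closedBall x r}) := by
    intro a
    have : Fact (0 < 2 * Real.pi) := ⟨Real.two_pi_pos⟩
    obtain ⟨α, ⟨ha0, ha1⟩, rfl⟩ : a ∈ ((↑) : ℝ → AddCircle (2 * Real.pi)) ''
        Ico 0 (0 + 2 * Real.pi) := by
      rw [AddCircle.coe_image_Ico_eq]; trivial
    obtain ⟨t, h, ht, hseg⟩ : ∃ t h : ℝ, -1 / 2 ≤ t ∧ ∀ τ : ℝ, t ≤ τ → τ ≤ t + 1 →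
        Complex.exp (α * Complex.I) * ((τ : ℂ) + h * Complex.I) ∈ F := by
      rcases lt_or_ge α Real.pi with hlt | hge
      · obtain ⟨p, hp⟩ := hk α ⟨ha0, hlt⟩
        exact kk_norm E α p hp
      · obtain ⟨p, hp⟩ := hk (α - Real.pi) ⟨by linarith, by linarith⟩
        obtain ⟨t, h, ht, hs⟩ := kk_norm E (α - Real.pi) p hp
        refine ⟨t, h, ht, fun τ h1 h2 => ?_⟩
        have := hFneg _ (hs τ h1 h2)
        convert this using 1
        push_cast
        rw [sub_mul, Complex.exp_sub, Complex.exp_pi_mul_I]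
        ring
    exact kk_dir F V hFV hVo hF0 hFstar α t h ht hseg
  choose x r hr0 hr1 hmem harea using hdir
  have hfin := kk_vitali V hVo.measurableSet (1 / 32) (by norm_num) x r hr0 hr1 hmem harea
  have hVU : volume V ≤ 2 * volume U := by
    refine (measure_union_le _ _).trans ?_
    rw [Measure.measure_neg, two_mul]
  have h2 : 2 * ENNReal.ofReal (Real.pi / 98) ≤ 2 * volume U := by
    refine le_trans ?_ (hfin.trans hVU)
    rw [show (2 : ENNReal) = ENNReal.ofReal 2 by simp, ← ENNReal.ofReal_mul (by norm_num)]
    apply ENNReal.ofReal_le_ofReal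
    have := Real.pi_pos
    rw [le_div_iff₀ (by norm_num)]
    norm_num
    linarith
  exact (ENNReal.mul_le_mul_iff_right (by norm_num) (by norm_num)).1 h2

/-- The improved bound: every star-shaped Kakeya set `E ⊂ ℝ²` (star-shaped about some
point `O ∈ E`, containing a unit segment in every direction `α ∈ [0,π)`) satisfies
`ℒ₂*(E) ≥ π/98`. -/
theorem starshaped_kakeya_improved (E : Set (EuclideanSpace ℝ (Fin 2)))
    (O : EuclideanSpace ℝ (Fin 2)) (hO : O ∈ E)
    (hstar : ∀ x ∈ E, segment ℝ O x ⊆ E)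
    (hkakeya : ∀ α ∈ Set.Ico 0 Real.pi,
      ∃ p : EuclideanSpace ℝ (Fin 2), segment ℝ p (p + dirVec α) ⊆ E) :
    ENNReal.ofReal (Real.pi / 98) ≤ volume E := by
  set φ := Complex.orthonormalBasisOneI.repr with hφ
  have hmp : volume ((fun z : ℂ => O + φ z) ⁻¹' E) = volume E := by
    have h1 : (fun z : ℂ => O + φ z) ⁻¹' E =
        φ.toMeasurableEquiv ⁻¹' ((fun y => O + y) ⁻¹' E) := rfl
    rw [h1, (φ.measurePreserving.measure_preimage_equiv (f := φ.toMeasurableEquiv)),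
      measure_preimage_add]
  rw [← hmp]
  apply kk_complex
  · simpa using hO
  · intro x hx s hs0 hs1
    have : O + φ ((s : ℂ) * x) ∈ segment ℝ O (O + φ x) := by
      refine ⟨1 - s, s, by linarith, hs0, by ring, ?_⟩
      rw [← Complex.real_smul, map_smul]
      module
    exact hstar _ hx this
  · intro α hα
    obtain ⟨p, hp⟩ := hkakeya α hα
    refine ⟨φ.symm (p - O), fun s hs0 hs1 => ?_⟩
    have hd : φ (Complex.exp (α * Complex.I)) = dirVec α := by
      rw [Complex.exp_mul_I, ← Complex.ofReal_cos, ← Complex.ofReal_sin]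
      ext i
      fin_cases i <;> simp [hφ, dirVec, -Complex.ofReal_cos, -Complex.ofReal_sin, Complex.orthonormalBasisOneI_repr_apply]
    apply hp
    refine ⟨1 - s, s, by linarith, hs0, by ring, ?_⟩
    show _ = O + φ _
    rw [map_add, ← Complex.real_smul, map_smul, hd, LinearIsometryEquiv.apply_symm_apply]
    module
end
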